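/- Let K be any field. Then the K-algebra L_K(1,2) ⊗_K L_K(1,2) is not isomorphic to L_K(1,2) as a K-algebra. -/

import Mathlib

/-- The defining relations of the Leavitt algebra `L_K(1,n)`: generators
`x₁, …, xₙ` (encoded as `Sum.inl i`) and `y₁, …, yₙ` (encoded as `Sum.inr i`), subject to
`yᵢ xⱼ = δᵢⱼ 1` and `∑ᵢ xᵢ yᵢ = 1`. -/
inductive LeavittRel (K : Type) [Field K] (n : ℕ) :
    FreeAlgebra K (Fin n ⊕ Fin n) → FreeAlgebra K (Fin n ⊕ Fin n) → Prop
  | yx_self (i : Fin n) :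
      LeavittRel K n (FreeAlgebra.ι K (Sum.inr i) * FreeAlgebra.ι K (Sum.inl i)) 1
  | yx_ne {i j : Fin n} (h : i ≠ j) :
      LeavittRel K n (FreeAlgebra.ι K (Sum.inr i) * FreeAlgebra.ι K (Sum.inl j)) 0
  | xy_sum :
      LeavittRel K n (∑ i : Fin n, FreeAlgebra.ι K (Sum.inl i) * FreeAlgebra.ι K (Sum.inr i)) 1

/-- The Leavitt algebra `L_K(1,n)` of type `(1,n)`. -/
abbrev LeavittAlgebra (K : Type) [Field K] (n : ℕ) : Type :=
  RingQuot (LeavittRel K n)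

open scoped TensorProduct

/-- Families `x`, `y` in a ring satisfying the defining relations of the Leavitt algebra of
type `(1,n)`. -/
structure IsLeavittPair {A : Type*} [Ring A] {n : ℕ} (x y : Fin n → A) : Prop where
  mul_eq_ite : ∀ i j, y i * x j = if i = j then 1 else 0
  sum_mul : ∑ i, x i * y i = 1

namespace IsLeavittPair

variable {A B : Type*} [Ring A] [Ring B] {n : ℕ} {x y : Fin n → A}

theorem map (h : IsLeavittPair x y) {F : Type*} [FunLike F A B] [RingHomClass F A B] (f : F) :
    IsLeavittPair (fun i => f (x i)) (fun i => f (y i)) where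
  mul_eq_ite i j := by rw [← map_mul, h.mul_eq_ite]; split_ifs <;> simp
  sum_mul := by simp_rw [← map_mul, ← map_sum, h.sum_mul, map_one]

/-- An element commuting with the row of a Leavitt pair commutes with its column. -/
theorem commute_right (h : IsLeavittPair x y) {z : A} (hz : ∀ i, Commute z (x i)) (i : Fin n) :
    Commute z (y i) := by
  have key : ∑ j, y i * z * (x j * y j) = ∑ j, y i * x j * (z * y j) :=
    Finset.sum_congr rfl fun j _ => by
      rw [mul_assoc, ← mul_assoc z, (hz j).eq]; simp only [mul_assoc]
  rw [← Finset.mul_sum, h.sum_mul, mul_one] at key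
  simp only [h.mul_eq_ite, ite_mul, one_mul, zero_mul, Finset.sum_ite_eq, Finset.mem_univ,
    if_true] at key
  exact key.symm

/-- The matrix of products `y i * x j` is idempotent as soon as `∑ i, x i * y i = 1`, so it is
the identity once it is so modulo a square-zero ideal. -/
theorem of_map_of_sum_mul {f : A →+* B} (hf : ∀ a b, f a = 0 → f b = 0 → a * b = 0)
    (hxy : IsLeavittPair (fun i => f (x i)) (fun i => f (y i))) (hs : ∑ i, x i * y i = 1) :
    IsLeavittPair x y := by
  let P : Matrix (Fin n) (Fin n) A := Matrix.of fun i j => y i * x j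
  have hP : P * P = P := by
    ext i j
    simp only [P, Matrix.mul_apply, Matrix.of_apply]
    calc ∑ k, y i * x k * (y k * x j) = y i * (∑ k, x k * y k) * x j := by
          simp only [Finset.mul_sum, Finset.sum_mul, mul_assoc]
      _ = y i * x j := by rw [hs, mul_one]
  have hker : ∀ i j, f ((P - 1) i j) = 0 := fun i j => by
    have := hxy.mul_eq_ite i j
    simp only [P, Matrix.sub_apply, Matrix.of_apply, map_sub, map_mul, this, Matrix.one_apply]
    split_ifs <;> simp
  have hsq : (P - 1) * (P - 1) = 0 := by
    ext i j
    rw [Matrix.mul_apply]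
    exact Finset.sum_eq_zero fun k _ => hf _ _ (hker i k) (hker k j)
  have hone : P = 1 := by
    have : (P - 1) * (P - 1) = 1 - P := by rw [sub_mul, mul_sub, hP]; simp
    rw [this] at hsq
    exact (sub_eq_zero.mp hsq).symm
  refine ⟨fun i j => ?_, hs⟩
  have := congrFun (congrFun hone i) j
  rwa [Matrix.one_apply] at this

/-- Leavitt pairs lift along surjections with square-zero kernel. -/
theorem exists_lift {f : A →+* B} (hf : ∀ a b, f a = 0 → f b = 0 → a * b = 0)
    (hsurj : Function.Surjective f) {x y : Fin n → B} (h : IsLeavittPair x y) :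
    ∃ x' y' : Fin n → A, IsLeavittPair x' y' ∧ (∀ i, f (x' i) = x i) ∧ ∀ i, f (y' i) = y i := by
  choose x₀ hx₀ using fun i => hsurj (x i)
  choose y' hy' using fun i => hsurj (y i)
  set m : A := ∑ i, x₀ i * y' i - 1 with hm
  have hfm : f m = 0 := by simp [hm, hx₀, hy', h.sum_mul]
  have hx' : ∀ i, f ((1 - m) * x₀ i) = x i := fun i => by simp [hfm, hx₀]
  refine ⟨fun i => (1 - m) * x₀ i, y', of_map_of_sum_mul hf ?_ ?_, hx', hy'⟩
  · simpa only [hx', hy'] using h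
  · have hs : ∑ i, x₀ i * y' i = 1 + m := by rw [hm]; abel
    simp_rw [mul_assoc, ← Finset.mul_sum, hs, mul_add, sub_mul, hf m m hfm hfm]
    simp

end IsLeavittPair

namespace LeavittAlgebra

variable (K : Type) [Field K] (n : ℕ)

/-- The generator `xᵢ` of the Leavitt algebra. -/
noncomputable def x (i : Fin n) : LeavittAlgebra K n :=
  RingQuot.mkAlgHom K (LeavittRel K n) (FreeAlgebra.ι K (Sum.inl i))

/-- The generator `yᵢ` of the Leavitt algebra. -/
noncomputable def y (i : Fin n) : LeavittAlgebra K n :=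
  RingQuot.mkAlgHom K (LeavittRel K n) (FreeAlgebra.ι K (Sum.inr i))

theorem isLeavittPair : IsLeavittPair (x K n) (y K n) where
  mul_eq_ite i j := by
    rw [x, y, ← map_mul]
    split_ifs with hij
    · subst hij
      rw [RingQuot.mkAlgHom_rel K (LeavittRel.yx_self i), map_one]
    · rw [RingQuot.mkAlgHom_rel K (LeavittRel.yx_ne hij), map_zero]
  sum_mul := by
    simp_rw [x, y, ← map_mul, ← map_sum]
    rw [RingQuot.mkAlgHom_rel K LeavittRel.xy_sum, map_one]

variable {K n} {A B : Type*} [Ring A] [Algebra K A] [Ring B] [Algebra K B]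

/-- The universal property of the Leavitt algebra. -/
theorem exists_algHom {a b : Fin n → A} (h : IsLeavittPair a b) :
    ∃ f : LeavittAlgebra K n →ₐ[K] A, (∀ i, f (x K n i) = a i) ∧ ∀ i, f (y K n i) = b i := by
  refine ⟨RingQuot.liftAlgHom K ⟨FreeAlgebra.lift K (Sum.elim a b), fun r s hrs => ?_⟩,
    fun i => by simp [x], fun i => by simp [y]⟩
  cases hrs with
  | yx_self i => simp [h.mul_eq_ite]
  | yx_ne hij => simp [h.mul_eq_ite, hij]
  | xy_sum => simpa using h.sum_mul

@[elab_as_elim]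
theorem induction {p : LeavittAlgebra K n → Prop} (algebraMap : ∀ r, p (algebraMap K _ r))
    (x : ∀ i, p (x K n i)) (y : ∀ i, p (y K n i)) (mul : ∀ a b, p a → p b → p (a * b))
    (add : ∀ a b, p a → p b → p (a + b)) (a : LeavittAlgebra K n) : p a := by
  obtain ⟨a, rfl⟩ := RingQuot.mkAlgHom_surjective K (LeavittRel K n) a
  induction a using FreeAlgebra.induction with
  | grade0 r => simpa using algebraMap r
  | grade1 s =>
    cases s with
    | inl i => exact x i
    | inr i => exact y i
  | mul a b ha hb => simpa using mul _ _ ha hb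
  | add a b ha hb => simpa using add _ _ ha hb

theorem algHom_ext {f g : LeavittAlgebra K n →ₐ[K] A} (hx : ∀ i, f (x K n i) = g (x K n i))
    (hy : ∀ i, f (y K n i) = g (y K n i)) : f = g := by
  refine AlgHom.ext fun a => ?_
  induction a using induction with
  | algebraMap r => simp
  | x i => exact hx i
  | y i => exact hy i
  | mul a b ha hb => rw [map_mul, map_mul, ha, hb]
  | add a b ha hb => rw [map_add, map_add, ha, hb]

theorem commute_map {f : LeavittAlgebra K n →ₐ[K] A} {z : A}
    (hz : ∀ i, Commute z (f (x K n i))) (a : LeavittAlgebra K n) : Commute z (f a) := by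
  induction a using induction with
  | algebraMap r => rw [AlgHom.commutes]; exact (Algebra.commutes r z).symm
  | x i => exact hz i
  | y i => exact ((isLeavittPair K n).map f).commute_right hz i
  | mul a b ha hb => rw [map_mul]; exact ha.mul_right hb
  | add a b ha hb => rw [map_add]; exact ha.add_right hb

theorem commute_map_map {f g : LeavittAlgebra K n →ₐ[K] A}
    (h : ∀ i j, Commute (f (x K n i)) (g (x K n j))) (a b : LeavittAlgebra K n) :
    Commute (f a) (g b) :=
  commute_map (fun j => (commute_map (fun i => (h i j).symm) a).symm) b

/-- The Leavitt algebra is quasi-free: homomorphisms out of it lift along surjections with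
square-zero kernel. -/
theorem exists_algHom_lift {p : A →ₐ[K] B} (hp : ∀ a b, p a = 0 → p b = 0 → a * b = 0)
    (hsurj : Function.Surjective p) (f : LeavittAlgebra K n →ₐ[K] B) :
    ∃ g : LeavittAlgebra K n →ₐ[K] A, p.comp g = f := by
  obtain ⟨a, b, hab, ha, hb⟩ :=
    ((isLeavittPair K n).map f).exists_lift (f := p.toRingHom) hp hsurj
  obtain ⟨g, hgx, hgy⟩ := exists_algHom (K := K) hab
  exact ⟨g, algHom_ext (fun i => by simpa [hgx] using ha i) fun i => by simpa [hgy] using hb i⟩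

end LeavittAlgebra

section UpperTriangular

variable (K R : Type*) [Field K] [Ring R] [Algebra K R]

/-- The algebra of upper triangular `3 × 3` matrices. -/
def upperTriangularThree : Subalgebra K (Matrix (Fin 3) (Fin 3) R) where
  carrier := {M | M.BlockTriangular id}
  mul_mem' := Matrix.BlockTriangular.mul
  add_mem' := Matrix.BlockTriangular.add
  algebraMap_mem' _ := Matrix.blockTriangular_diagonal _

variable {K R}

theorem apply_eq_zero_of_mem_upperTriangularThree (M : upperTriangularThree K R) {i j : Fin 3}
    (h : j < i) : M.1 i j = 0 :=
  M.2 h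

variable (K R) in
/-- Forgetting the upper right entry of an upper triangular `3 × 3` matrix: the pair of its
diagonal `2 × 2` blocks. -/
def diagonalBlocks : upperTriangularThree K R →ₐ[K]
    Matrix (Fin 2) (Fin 2) R × Matrix (Fin 2) (Fin 2) R :=
  AlgHom.ofLinearMap
    { toFun := fun M => (M.1.submatrix Fin.castSucc Fin.castSucc, M.1.submatrix Fin.succ Fin.succ)
      map_add' := fun _ _ => rfl
      map_smul' := fun _ _ => rfl }
    (by
      refine Prod.ext ?_ ?_
      · exact Matrix.submatrix_one _ (Fin.castSucc_injective 2)
      · exact Matrix.submatrix_one _ (Fin.succ_injective 2))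
    (fun M N => by
      have h₁ := apply_eq_zero_of_mem_upperTriangularThree M (show (0 : Fin 3) < 1 by decide)
      have h₂ := apply_eq_zero_of_mem_upperTriangularThree M (show (0 : Fin 3) < 2 by decide)
      have h₃ := apply_eq_zero_of_mem_upperTriangularThree N (show (0 : Fin 3) < 2 by decide)
      have h₄ := apply_eq_zero_of_mem_upperTriangularThree N (show (1 : Fin 3) < 2 by decide)
      refine Prod.ext ?_ ?_
      · change (M.1 * N.1).submatrix _ _ = M.1.submatrix _ _ * N.1.submatrix _ _
        ext i j
        fin_cases i <;> fin_cases j <;> simp [Matrix.mul_apply, Fin.sum_univ_three, h₃, h₄]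
      · change (M.1 * N.1).submatrix _ _ = M.1.submatrix _ _ * N.1.submatrix _ _
        ext i j
        fin_cases i <;> fin_cases j <;> simp [Matrix.mul_apply, Fin.sum_univ_three, h₁, h₂])

theorem diagonalBlocks_eq_iff {M N : upperTriangularThree K R} :
    diagonalBlocks K R M = diagonalBlocks K R N ↔
      ∀ i j, (i, j) ≠ (0, 2) → M.1 i j = N.1 i j := by
  constructor
  · intro h i j hij
    have h₁ : ∀ a b : Fin 2, M.1 a.castSucc b.castSucc = N.1 a.castSucc b.castSucc :=
      fun a b => congrFun (congrFun (congrArg Prod.fst h) a) b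
    have h₂ : ∀ a b : Fin 2, M.1 a.succ b.succ = N.1 a.succ b.succ :=
      fun a b => congrFun (congrFun (congrArg Prod.snd h) a) b
    fin_cases i <;> fin_cases j
    · exact h₁ 0 0
    · exact h₁ 0 1
    · exact absurd rfl hij
    · exact h₁ 1 0
    · exact h₁ 1 1
    · exact h₂ 0 1
    · exact (apply_eq_zero_of_mem_upperTriangularThree M (by decide)).trans (apply_eq_zero_of_mem_upperTriangularThree N (by decide)).symm
    · exact h₂ 1 0
    · exact h₂ 1 1
  · intro h
    refine Prod.ext ?_ ?_ <;> ext i j <;> refine h _ _ ?_ <;> revert i j <;> decide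

theorem mul_eq_zero_of_diagonalBlocks_eq_zero (M N : upperTriangularThree K R)
    (hM : diagonalBlocks K R M = 0) (hN : diagonalBlocks K R N = 0) : M * N = 0 := by
  rw [← map_zero (diagonalBlocks K R), diagonalBlocks_eq_iff] at hM hN
  ext i j
  rw [MulMemClass.coe_mul, Matrix.mul_apply]
  refine Finset.sum_eq_zero fun k _ => ?_
  by_cases hk : k = 2
  · rw [hN k j (by simp [hk])]; simp
  · rw [hM i k (by simp [hk])]; simp

variable (K) in
/-- The upper triangular matrix with constant diagonal `a` and superdiagonal `b`, `c`. -/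
def bidiagonal (a b c : R) : upperTriangularThree K R :=
  ⟨!![a, b, 0; 0, a, c; 0, 0, a], fun i j h => by
    revert h; fin_cases i <;> fin_cases j <;> simp⟩

theorem IsLeavittPair.bidiagonal_left {n : ℕ} {x y : Fin n → R} (h : IsLeavittPair x y) :
    IsLeavittPair (fun i => bidiagonal K (x i) (x i) 0)
      (fun i => bidiagonal K (y i) (-y i) 0) where
  mul_eq_ite i j := by
    ext k l
    have := h.mul_eq_ite i j
    split_ifs at this ⊢ <;> fin_cases k <;> fin_cases l <;>
      simp [bidiagonal, Matrix.mul_apply, Fin.sum_univ_succ, this]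
  sum_mul := by
    ext k l
    have := h.sum_mul
    fin_cases k <;> fin_cases l <;>
      simp [bidiagonal, Matrix.sum_apply, this]

theorem IsLeavittPair.bidiagonal_right {n : ℕ} {x y : Fin n → R} (h : IsLeavittPair x y) :
    IsLeavittPair (fun i => bidiagonal K (x i) 0 (x i))
      (fun i => bidiagonal K (y i) 0 (-y i)) where
  mul_eq_ite i j := by
    ext k l
    have := h.mul_eq_ite i j
    split_ifs at this ⊢ <;> fin_cases k <;> fin_cases l <;>
      simp [bidiagonal, Matrix.mul_apply, Fin.sum_univ_succ, this]
  sum_mul := by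
    ext k l
    have := h.sum_mul
    fin_cases k <;> fin_cases l <;>
      simp [bidiagonal, Matrix.sum_apply, this]

end UpperTriangular

/-- In an algebra with two commuting Leavitt pairs and a suitably invariant functional, the
homomorphism from `L ⊗ L` to upper triangular matrices modulo the corner does not lift. -/
theorem isEmpty_tensor_algEquiv_of_functional {K : Type} [Field K] {n : ℕ} {R : Type*} [Ring R]
    [Algebra K R] {x y u v : Fin n → R} (hxy : IsLeavittPair x y) (huv : IsLeavittPair u v)
    (hxu : ∀ i j, Commute (x i) (u j)) (i : Fin n) (φ : R →ₗ[K] K) (h1 : φ 1 ≠ 0)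
    (hx_left : ∀ a, φ (x i * a) = φ a) (hx_right : ∀ a, φ (a * x i) = φ a)
    (hu_left : ∀ a, φ (u i * a) = φ a) (hu_right : ∀ a, φ (a * u i) = φ a) :
    IsEmpty ((LeavittAlgebra K n ⊗[K] LeavittAlgebra K n) ≃ₐ[K] LeavittAlgebra K n) := by
  refine ⟨fun e => ?_⟩
  obtain ⟨f, hf, -⟩ := LeavittAlgebra.exists_algHom (K := K) (hxy.bidiagonal_left (K := K))
  obtain ⟨g, hg, -⟩ := LeavittAlgebra.exists_algHom (K := K) (huv.bidiagonal_right (K := K))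
  let p := (diagonalBlocks K R).rangeRestrict
  have hp : ∀ {M N}, p M = p N ↔ diagonalBlocks K R M = diagonalBlocks K R N :=
    Subtype.ext_iff
  have hcomm : ∀ a b, Commute ((p.comp f) a) ((p.comp g) b) :=
    LeavittAlgebra.commute_map_map fun j k => by
      simp only [AlgHom.comp_apply, hf, hg, Commute, SemiconjBy]
      rw [← map_mul, ← map_mul, hp, diagonalBlocks_eq_iff]
      intro r s hrs
      have := (hxu j k).eq
      revert hrs
      fin_cases r <;> fin_cases s <;>
        simp [bidiagonal, Matrix.mul_apply, Fin.sum_univ_succ, this]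
  obtain ⟨F, hF⟩ := LeavittAlgebra.exists_algHom_lift (p := p)
    (fun M N hM hN => mul_eq_zero_of_diagonalBlocks_eq_zero M N
      (by simpa [p] using congrArg Subtype.val hM) (by simpa [p] using congrArg Subtype.val hN))
    (AlgHom.rangeRestrict_surjective _)
    ((Algebra.TensorProduct.lift (p.comp f) (p.comp g) hcomm).comp e.symm.toAlgHom)
  let t := LeavittAlgebra.x K n i
  let M := F (e (t ⊗ₜ 1))
  let N := F (e (1 ⊗ₜ t))
  have hM : p M = p (bidiagonal K (x i) (x i) 0) := by
    have := AlgHom.congr_fun hF (e (t ⊗ₜ 1))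
    simpa [t, hf] using this
  have hN : p N = p (bidiagonal K (u i) 0 (u i)) := by
    have := AlgHom.congr_fun hF (e (1 ⊗ₜ t))
    simpa [t, hg] using this
  have hMN : M * N = N * M := by
    simp only [M, N, ← map_mul, Algebra.TensorProduct.tmul_mul_tmul, one_mul, mul_one]
  rw [hp, diagonalBlocks_eq_iff] at hM hN
  have key := congrFun (congrFun (congrArg Subtype.val hMN) 0) 2
  simp only [MulMemClass.coe_mul, Matrix.mul_apply, Fin.sum_univ_three] at key
  rw [hM 0 0 (by decide), hM 0 1 (by decide), hM 1 2 (by decide), hM 2 2 (by decide),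
    hN 0 0 (by decide), hN 0 1 (by decide), hN 1 2 (by decide), hN 2 2 (by decide)] at key
  have hφ := congrArg φ key
  have hu1 : φ (u i) = φ 1 := by rw [← hu_left 1, mul_one]
  simp [bidiagonal, hx_left, hx_right, hu_left, hu_right, hu1] at hφ
  apply h1
  linear_combination hφ

theorem isEmpty_tensor_square_algEquiv_of_functional {K : Type} [Field K] {n : ℕ} {A : Type*}
    [Ring A] [Algebra K A] {x y : Fin n → A} (h : IsLeavittPair x y) (i : Fin n) (φ : A →ₗ[K] K)
    (h1 : φ 1 ≠ 0) (h_left : ∀ a, φ (x i * a) = φ a) (h_right : ∀ a, φ (a * x i) = φ a) :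
    IsEmpty ((LeavittAlgebra K n ⊗[K] LeavittAlgebra K n) ≃ₐ[K] LeavittAlgebra K n) := by
  let Φ : A ⊗[K] A →ₗ[K] K := LinearMap.mul' K K ∘ₗ TensorProduct.map φ φ
  have hΦ : ∀ a b : A, Φ (a ⊗ₜ b) = φ a * φ b := fun a b => by simp [Φ]
  have hext : ∀ ψ : A ⊗[K] A →ₗ[K] A ⊗[K] A, (∀ a b : A, Φ (ψ (a ⊗ₜ b)) = Φ (a ⊗ₜ b)) →
      ∀ c, Φ (ψ c) = Φ c := fun ψ hψ => LinearMap.congr_fun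
    (TensorProduct.ext' (g := Φ ∘ₗ ψ) hψ)
  refine isEmpty_tensor_algEquiv_of_functional
    (h.map (Algebra.TensorProduct.includeLeft : A →ₐ[K] A ⊗[K] A))
    (h.map (Algebra.TensorProduct.includeRight : A →ₐ[K] A ⊗[K] A))
    (fun i j => ?_) i Φ ?_ (hext (LinearMap.mulLeft K _) ?_) (hext (LinearMap.mulRight K _) ?_)
    (hext (LinearMap.mulLeft K _) ?_) (hext (LinearMap.mulRight K _) ?_)
  · simp [Commute, SemiconjBy]
  · rw [Algebra.TensorProduct.one_def, hΦ]
    exact mul_ne_zero h1 h1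
  all_goals
    intro a b
    simp [hΦ, h_left, h_right]

section Functions

variable (K : Type*) [Field K] (n : ℕ) [NeZero n]

/-- The operator on sequences spreading a sequence over the residue class of `i` modulo `n`. -/
def spread (i : Fin n) : Module.End K (ℕ → K) where
  toFun F a := if (Nat.divModEquiv n a).2 = i then F (Nat.divModEquiv n a).1 else 0
  map_add' F G := by ext a; dsimp only [Pi.add_apply]; split_ifs <;> simp
  map_smul' c F := by ext a; simp

/-- The operator restricting a sequence to the residue class of `i` modulo `n`. -/
def restrictClass (i : Fin n) : Module.End K (ℕ → K) where
  toFun F a := F ((Nat.divModEquiv n).symm (a, i))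
  map_add' _ _ := rfl
  map_smul' _ _ := rfl

theorem isLeavittPair_spread : IsLeavittPair (spread K n) (restrictClass K n) where
  mul_eq_ite i j := by
    refine LinearMap.ext fun F => funext fun a => ?_
    simp only [Module.End.mul_apply, restrictClass, spread, LinearMap.coe_mk, AddHom.coe_mk,
      Equiv.apply_symm_apply]
    split_ifs <;> simp
  sum_mul := by
    refine LinearMap.ext fun F => funext fun a => ?_
    simp only [LinearMap.sum_apply, Finset.sum_apply, Module.End.mul_apply, restrictClass, spread,
      LinearMap.coe_mk, AddHom.coe_mk, Finset.sum_ite_eq, Finset.mem_univ, if_true,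
      Prod.mk.eta, Equiv.symm_apply_apply, Module.End.one_apply]

/-- The matrix coefficient of an operator on sequences at the index `0`. -/
def zeroCoeff : Module.End K (ℕ → K) →ₗ[K] K where
  toFun T := T (Pi.single 0 1) 0
  map_add' _ _ := rfl
  map_smul' _ _ := rfl

theorem zeroCoeff_one : zeroCoeff K 1 = 1 := by simp [zeroCoeff]

theorem zeroCoeff_spread_mul (T : Module.End K (ℕ → K)) :
    zeroCoeff K (spread K n 0 * T) = zeroCoeff K T := by
  simp [zeroCoeff, spread]

theorem zeroCoeff_mul_spread (T : Module.End K (ℕ → K)) :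
    zeroCoeff K (T * spread K n 0) = zeroCoeff K T := by
  have : spread K n 0 (Pi.single 0 1) = Pi.single 0 1 := by
    ext a
    have h0 : Nat.divModEquiv n 0 = (0, 0) := by simp
    have : a = 0 ↔ (Nat.divModEquiv n a).2 = 0 ∧ (Nat.divModEquiv n a).1 = 0 := by
      rw [← (Nat.divModEquiv n).apply_eq_iff_eq, h0, Prod.ext_iff, and_comm]
    simp only [spread, LinearMap.coe_mk, AddHom.coe_mk, Pi.single_apply]
    rw [← ite_and]
    simp only [this]
  simp [zeroCoeff, this]

end Functions

/-- The tensor square of the Leavitt algebra of type `(1,n)` is not isomorphic to it. -/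
theorem isEmpty_tensor_square_algEquiv (K : Type) [Field K] (n : ℕ) [NeZero n] :
    IsEmpty ((LeavittAlgebra K n ⊗[K] LeavittAlgebra K n) ≃ₐ[K] LeavittAlgebra K n) :=
  isEmpty_tensor_square_algEquiv_of_functional (isLeavittPair_spread K n) 0 (zeroCoeff K)
    (by simp [zeroCoeff_one]) (zeroCoeff_spread_mul K n) (zeroCoeff_mul_spread K n)

/-- `L_K(1,2) ⊗_K L_K(1,2)` is not isomorphic to `L_K(1,2)` as a `K`-algebra. -/
theorem tensor_square_not_iso (K : Type) [Field K] :
    IsEmpty ((LeavittAlgebra K 2 ⊗[K] LeavittAlgebra K 2) ≃ₐ[K] LeavittAlgebra K 2) :=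
  isEmpty_tensor_square_algEquiv K 2
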